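/- Let θ_c > 0 be real, let c ∈ ℂ, let w ≥ 0 be real, and let u ∈ ℂ be any square root of c²θ_c² + w. Then e^{cθ_c} + Σ_{n=1}^∞ (w^n / ((2θ_c)^{2n} n! (n-1)!)) · ∫_{-θ_c}^{θ_c} (θ_c² - θ²)^{n-1} (θ_c + θ) e^{cθ} dθ = cosh(u) + (c θ_c) · sinh(u)/u, where sinh(u)/u is understood as 1 when u = 0. -/

import Mathlib

open Real

lemma HasSum.tel_congr {f g : ℕ → ℂ} {s : ℂ} (h : HasSum f s) (e : ∀ n, g n = f n) :
    HasSum g s := by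
  rwa [show g = f from funext e]

lemma tel_moment_odd (t : ℝ) (n j : ℕ) :
    ∫ x in (-t)..t, (t ^ 2 - x ^ 2) ^ n * x ^ (2 * j + 1) = 0 := by
  have h := intervalIntegral.integral_comp_neg (a := -t) (b := t)
    (fun x : ℝ => (t ^ 2 - x ^ 2) ^ n * x ^ (2 * j + 1))
  have h2 : ∀ x : ℝ, (t ^ 2 - (-x) ^ 2) ^ n * (-x) ^ (2 * j + 1)
      = -((t ^ 2 - x ^ 2) ^ n * x ^ (2 * j + 1)) := by
    intro x
    rw [Odd.neg_pow ⟨j, rfl⟩, neg_sq]; ring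
  simp only [h2, intervalIntegral.integral_neg, neg_neg] at h
  linarith

lemma tel_moment_rec (t : ℝ) (n j : ℕ) :
    (2 * j + 1 : ℝ) * ∫ x in (-t)..t, (t ^ 2 - x ^ 2) ^ (n + 1) * x ^ (2 * j) =
      2 * (n + 1) * ∫ x in (-t)..t, (t ^ 2 - x ^ 2) ^ n * x ^ (2 * (j + 1)) := by
  have h := intervalIntegral.integral_mul_deriv_eq_deriv_mul (a := -t) (b := t)
    (u := fun x : ℝ => (t ^ 2 - x ^ 2) ^ (n + 1))
    (u' := fun x : ℝ => (n + 1) * (t ^ 2 - x ^ 2) ^ n * (-(2 * x)))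
    (v := fun x : ℝ => x ^ (2 * j + 1))
    (v' := fun x : ℝ => (2 * j + 1) * x ^ (2 * j))
    (by
      intro x _
      have h1 : HasDerivAt (fun x : ℝ => t ^ 2 - x ^ 2) (-(2 * x)) x := by
        simpa using (hasDerivAt_pow 2 x).const_sub (t ^ 2)
      simpa using h1.fun_pow (n + 1))
    (by
      intro x _
      simpa using hasDerivAt_pow (2 * j + 1) x)
    (Continuous.intervalIntegrable (by fun_prop) _ _)
    (Continuous.intervalIntegrable (by fun_prop) _ _)
  simp only [even_two, Even.neg_pow, sub_self, ne_eq, Nat.add_eq_zero_iff, one_ne_zero, and_false,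
    not_false_eq_true, zero_pow, zero_mul, zero_sub] at h
  rw [← intervalIntegral.integral_const_mul, ← intervalIntegral.integral_const_mul]
  rw [← intervalIntegral.integral_neg] at h
  convert h using 1
  · congr 1; ext x; ring
  · congr 1; ext x; ring

lemma tel_moment (t : ℝ) (n j : ℕ) :
    ∫ x in (-t)..t, (t ^ 2 - x ^ 2) ^ n * x ^ (2 * j) =
      t ^ (2 * n + 2 * j + 1) * (4 ^ (n + 1) * n.factorial * (2 * j).factorial
        * (n + 1 + j).factorial / (j.factorial * (2 * (n + 1 + j)).factorial)) := by
  induction n generalizing j with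
  | zero =>
    simp only [pow_zero, one_mul, integral_pow]
    rw [Odd.neg_pow ⟨j, rfl⟩]
    rw [show 2 * (0 + 1 + j) = 2 * j + 1 + 1 by ring, show 0 + 1 + j = j + 1 by ring]
    simp only [Nat.factorial_succ, Nat.factorial_zero]
    have := Nat.factorial_ne_zero j
    have := Nat.factorial_ne_zero (2 * j)
    push_cast
    field_simp
    ring
  | succ n ih =>
    have h := tel_moment_rec t n j
    rw [ih] at h
    have h0 : (2 * j + 1 : ℝ) ≠ 0 := by positivity
    apply mul_left_cancel₀ h0
    rw [h]
    rw [show 2 * (j + 1) = 2 * j + 1 + 1 by ring, show n + 1 + 1 + j = n + 1 + (j + 1) by ring]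
    simp only [Nat.factorial_succ n, Nat.factorial_succ j, Nat.factorial_succ (2 * j),
      Nat.factorial_succ (2 * j + 1)]
    have := Nat.factorial_ne_zero j
    have := Nat.factorial_ne_zero (2 * (n + 1 + (j + 1)))
    push_cast
    field_simp
    ring

lemma tel_exp_hasSum (z : ℂ) :
    HasSum (fun j : ℕ => z ^ (2 * j) / ((2 * j).factorial : ℂ)
      + z ^ (2 * j + 1) / ((2 * j + 1).factorial : ℂ)) (Complex.exp z) := by
  rw [← Complex.cosh_add_sinh]
  exact (Complex.hasSum_cosh z).add (Complex.hasSum_sinh z)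

lemma tel_int_hasSum (t : ℝ) (ht : 0 < t) (c : ℂ) (n : ℕ) :
    HasSum (fun j : ℕ => ∫ x in (-t)..t, (((t ^ 2 - x ^ 2 : ℝ) ^ n * (t + x) : ℝ) : ℂ) *
        ((c * x) ^ (2 * j) / ((2 * j).factorial : ℂ)
      + (c * x) ^ (2 * j + 1) / ((2 * j + 1).factorial : ℂ)))
     (∫ x in (-t)..t, (((t ^ 2 - x ^ 2 : ℝ) ^ n * (t + x) : ℝ) : ℂ) * Complex.exp (c * x)) := by
  have hs : Summable fun j : ℕ => ((t ^ 2) ^ n * (2 * t)) *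
      ((‖c‖ * t) ^ (2 * j) / ((2 * j).factorial : ℝ)
      + (‖c‖ * t) ^ (2 * j + 1) / ((2 * j + 1).factorial : ℝ)) :=
    ((Real.hasSum_cosh _).add (Real.hasSum_sinh _)).summable.mul_left _
  apply intervalIntegral.hasSum_integral_of_dominated_convergence
    (fun j _ => ((t ^ 2) ^ n * (2 * t)) *
      ((‖c‖ * t) ^ (2 * j) / ((2 * j).factorial : ℝ)
      + (‖c‖ * t) ^ (2 * j + 1) / ((2 * j + 1).factorial : ℝ)))
  · intro j
    exact Continuous.aestronglyMeasurable (by fun_prop)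
  · intro j
    refine Filter.Eventually.of_forall fun x hx => ?_
    rw [Set.uIoc_of_le (by linarith)] at hx
    obtain ⟨h1, h2⟩ := hx
    have hx : |x| ≤ t := abs_le.2 ⟨h1.le, h2⟩
    have h3 : 0 ≤ t ^ 2 - x ^ 2 := by nlinarith
    have h4 : 0 ≤ t + x := by linarith
    rw [norm_mul]
    gcongr
    · rw [Complex.norm_real, Real.norm_of_nonneg (by positivity)]
      gcongr
      · nlinarith
      · linarith
    · refine (norm_add_le _ _).trans ?_
      simp only [norm_div, norm_pow, norm_mul, Complex.norm_natCast, Complex.norm_real, norm_eq_abs]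
      gcongr
  · exact Filter.Eventually.of_forall fun x hx => hs
  · exact intervalIntegrable_const
  · exact Filter.Eventually.of_forall fun x hx => (tel_exp_hasSum _).mul_left _

/-- the coefficient of `(a² + w)^k / k!` -/
noncomputable def telPhi (a : ℂ) (k : ℕ) : ℂ :=
  (k.factorial : ℂ) / ((2 * k).factorial : ℂ) + a * ((k.factorial : ℂ) / ((2 * k + 1).factorial : ℂ))

lemma tel_int_term (t : ℝ) (c : ℂ) (n j : ℕ) :
    ∫ x in (-t)..t, (((t ^ 2 - x ^ 2 : ℝ) ^ n * (t + x) : ℝ) : ℂ) *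
        ((c * x) ^ (2 * j) / ((2 * j).factorial : ℂ)
      + (c * x) ^ (2 * j + 1) / ((2 * j + 1).factorial : ℂ)) =
    c ^ (2 * j) / ((2 * j).factorial : ℂ) * t *
      ((∫ x in (-t)..t, (t ^ 2 - x ^ 2) ^ n * x ^ (2 * j) : ℝ) : ℂ) +
    c ^ (2 * j + 1) / ((2 * j + 1).factorial : ℂ) *
      ((∫ x in (-t)..t, (t ^ 2 - x ^ 2) ^ n * x ^ (2 * (j + 1)) : ℝ) : ℂ) := by
  have e : ∀ x : ℝ, (((t ^ 2 - x ^ 2 : ℝ) ^ n * (t + x) : ℝ) : ℂ) *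
        ((c * x) ^ (2 * j) / ((2 * j).factorial : ℂ)
      + (c * x) ^ (2 * j + 1) / ((2 * j + 1).factorial : ℂ)) =
      (c ^ (2 * j) / ((2 * j).factorial : ℂ) * t * (((t ^ 2 - x ^ 2) ^ n * x ^ (2 * j) : ℝ) : ℂ) +
      c ^ (2 * j + 1) / ((2 * j + 1).factorial : ℂ) *
        (((t ^ 2 - x ^ 2) ^ n * x ^ (2 * (j + 1)) : ℝ) : ℂ)) +
      (c ^ (2 * j) / ((2 * j).factorial : ℂ) + c ^ (2 * j + 1) / ((2 * j + 1).factorial : ℂ) * t) *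
        (((t ^ 2 - x ^ 2) ^ n * x ^ (2 * j + 1) : ℝ) : ℂ) := by
    intro x
    push_cast
    ring
  simp only [e]
  rw [intervalIntegral.integral_add (Continuous.intervalIntegrable (by fun_prop) _ _)
    (Continuous.intervalIntegrable (by fun_prop) _ _),
    intervalIntegral.integral_add (Continuous.intervalIntegrable (by fun_prop) _ _)
    (Continuous.intervalIntegrable (by fun_prop) _ _)]
  simp only [intervalIntegral.integral_const_mul, intervalIntegral.integral_ofReal,
    tel_moment_odd, Complex.ofReal_zero, mul_zero, add_zero]

lemma tel_row (t : ℝ) (ht : 0 < t) (c : ℂ) (w : ℝ) (n : ℕ) :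
    HasSum (fun j : ℕ => (w : ℂ) ^ (n + 1) / ((n + 1).factorial : ℂ) *
        (((c * t) ^ 2) ^ j / (j.factorial : ℂ)) * telPhi (c * t) (n + 1 + j))
      (((w ^ (n + 1) /
          ((2 * t) ^ (2 * (n + 1)) * (Nat.factorial (n + 1) : ℝ) * (Nat.factorial n : ℝ)) : ℝ) : ℂ) *
        ∫ θ in (-t)..t, ((t ^ 2 - θ ^ 2 : ℝ) ^ n * (t + θ) : ℝ) * Complex.exp (c * θ)) := by
  refine ((tel_int_hasSum t ht c n).mul_left _).tel_congr fun j => ?_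
  rw [tel_int_term, tel_moment, tel_moment, telPhi]
  have ht' : (t : ℂ) ≠ 0 := by exact_mod_cast ht.ne'
  rw [show n + 1 + (j + 1) = (n + 1 + j) + 1 by ring,
    show 2 * ((n + 1 + j) + 1) = 2 * (n + 1 + j) + 1 + 1 by ring,
    show 2 * (j + 1) = 2 * j + 1 + 1 by ring]
  generalize hk : n + 1 + j = k
  have h4 : (2 * t : ℂ) ^ (2 * (n + 1)) = 4 ^ (n + 1) * t ^ (2 * (n + 1)) := by
    rw [mul_pow, pow_mul]; norm_num
  simp only [Nat.factorial_succ k, Nat.factorial_succ j, Nat.factorial_succ (2 * j),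
      Nat.factorial_succ (2 * j + 1), Nat.factorial_succ (2 * k), Nat.factorial_succ (2 * k + 1)]
  have := Nat.factorial_ne_zero j
  have := Nat.factorial_ne_zero k
  have := Nat.factorial_ne_zero n
  have := Nat.factorial_ne_zero (n + 1)
  have := Nat.factorial_ne_zero (2 * k)
  have := Nat.factorial_ne_zero (2 * j)
  have h5 : (2 * (k : ℂ) + 1) ≠ 0 := by exact_mod_cast Nat.succ_ne_zero (2 * k)
  have h6 : (2 * (k : ℂ) + 1 + 1) ≠ 0 := by exact_mod_cast Nat.succ_ne_zero (2 * k + 1)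
  have h7 : (2 * (j : ℂ) + 1) ≠ 0 := by exact_mod_cast Nat.succ_ne_zero (2 * j)
  have h8 : (2 * (j : ℂ) + 1 + 1) ≠ 0 := by exact_mod_cast Nat.succ_ne_zero (2 * j + 1)
  have h9 : ((j : ℂ) + 1) ≠ 0 := by exact_mod_cast Nat.succ_ne_zero (j)
  have h10 : ((k : ℂ) + 1) ≠ 0 := by exact_mod_cast Nat.succ_ne_zero (k)
  push_cast
  rw [h4]
  field_simp
  ring

lemma tel_row_zero (a w : ℂ) :
    HasSum (fun j : ℕ => w ^ 0 / ((Nat.factorial 0 : ℕ) : ℂ) *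
        ((a ^ 2) ^ j / (j.factorial : ℂ)) * telPhi a (0 + j)) (Complex.exp a) := by
  convert tel_exp_hasSum a using 1
  ext j
  have := Nat.factorial_ne_zero j
  rw [telPhi, zero_add, ← pow_mul]
  simp only [pow_zero, Nat.factorial_zero, Nat.cast_one]
  field_simp
  ring

lemma telPhi_norm (a : ℂ) (k : ℕ) : ‖telPhi a k‖ ≤ 1 + ‖a‖ := by
  have key : ∀ m : ℕ, k ≤ m → ‖(k.factorial : ℂ) / (m.factorial : ℂ)‖ ≤ 1 := by
    intro m hm
    rw [norm_div, Complex.norm_natCast, Complex.norm_natCast]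
    apply div_le_one_of_le₀ _ (by positivity)
    exact_mod_cast Nat.factorial_le hm
  refine (norm_add_le _ _).trans ?_
  rw [norm_mul]
  have h1 := key (2 * k) (by omega)
  have h2 := mul_le_mul_of_nonneg_left (key (2 * k + 1) (by omega)) (norm_nonneg a)
  linarith

lemma tel_summable (a w : ℂ) :
    Summable (fun p : ℕ × ℕ => w ^ p.1 / (p.1.factorial : ℂ) *
        ((a ^ 2) ^ p.2 / (p.2.factorial : ℂ)) * telPhi a (p.1 + p.2)) := by
  have h := ((Real.summable_pow_div_factorial ‖w‖).mul_of_nonneg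
    (Real.summable_pow_div_factorial (‖a‖ ^ 2)) (fun n => by positivity)
    (fun n => by positivity)).mul_right (1 + ‖a‖)
  refine Summable.of_norm_bounded h fun p => ?_
  simp only [norm_mul, norm_div, norm_pow, Complex.norm_natCast]
  gcongr
  exact telPhi_norm a _

lemma tel_diag (a w u : ℂ) (hu : u ^ 2 = a ^ 2 + w) :
    HasSum (fun k : ℕ => (a ^ 2 + w) ^ k / (k.factorial : ℂ) * telPhi a k)
      (Complex.cosh u + a * (if u = 0 then 1 else Complex.sinh u / u)) := by
  have h2 : HasSum (fun k : ℕ => u ^ (2 * k) / ((2 * k + 1).factorial : ℂ))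
      (if u = 0 then 1 else Complex.sinh u / u) := by
    split_ifs with h
    · subst h
      convert hasSum_single (f := fun k : ℕ => (0 : ℂ) ^ (2 * k) / ((2 * k + 1).factorial : ℂ)) 0 ?_
        using 1
      · simp
      · intro b hb
        simp [hb]
    · refine ((Complex.hasSum_sinh u).div_const u).tel_congr fun k => ?_
      rw [pow_succ]
      field_simp
  convert (Complex.hasSum_cosh u).add (h2.mul_left a) using 1
  ext k
  have := Nat.factorial_ne_zero k
  rw [← hu, telPhi, ← pow_mul]
  field_simp

lemma tel_antidiag (a w : ℂ) (k : ℕ) :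
    ∑ p ∈ Finset.HasAntidiagonal.antidiagonal k, w ^ p.1 / (p.1.factorial : ℂ) *
        ((a ^ 2) ^ p.2 / (p.2.factorial : ℂ)) * telPhi a (p.1 + p.2) =
      (a ^ 2 + w) ^ k / (k.factorial : ℂ) * telPhi a k := by
  rw [add_comm (a ^ 2) w, (Commute.all w (a ^ 2)).add_pow', Finset.sum_div, Finset.sum_mul]
  refine Finset.sum_congr rfl fun p hp => ?_
  rw [Finset.HasAntidiagonal.mem_antidiagonal] at hp
  subst hp
  have h := Nat.add_choose_mul_factorial_mul_factorial p.1 p.2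
  rw [Nat.choose_symm_add.symm] at h
  have hch : (((p.1 + p.2).choose p.1 : ℕ) : ℂ) * (p.1.factorial : ℂ) * (p.2.factorial : ℂ)
    = ((p.1 + p.2).factorial : ℂ) := by exact_mod_cast h
  have := Nat.factorial_ne_zero p.1
  have := Nat.factorial_ne_zero p.2
  have := Nat.factorial_ne_zero (p.1 + p.2)
  rw [nsmul_eq_mul]
  field_simp
  rw [← hch]
  ring

/-- Summing the even-flip contributions (including the no-flip
Dirac term `e^{cθ_c}`) in the evaluation of the characteristic function of general
two-level telegraph noise:
`e^{cθ_c} + Σ_{n=1}^∞ (w^n/((2θ_c)^{2n} n! (n-1)!)) ∫_{-θ_c}^{θ_c} (θ_c²-θ²)^{n-1}(θ_c+θ)e^{cθ} dθ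
  = cosh(u) + cθ_c · sinh(u)/u`
where `u² = c²θ_c² + w` and `sinh(u)/u` is understood as `1` at `u = 0`. -/
theorem telegraph_even_flip_sum
    (θc : ℝ) (hθc : 0 < θc) (c : ℂ) (w : ℝ) (hw : 0 ≤ w) (u : ℂ)
    (hu : u ^ 2 = c ^ 2 * (θc : ℂ) ^ 2 + (w : ℂ)) :
    Complex.exp (c * θc) +
      ∑' n : ℕ, ((w ^ (n + 1) /
          ((2 * θc) ^ (2 * (n + 1)) * (Nat.factorial (n + 1) : ℝ) * (Nat.factorial n : ℝ)) : ℝ) : ℂ) *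
        ∫ θ in (-θc)..θc, ((θc ^ 2 - θ ^ 2 : ℝ) ^ n * (θc + θ) : ℝ) * Complex.exp (c * θ) =
    Complex.cosh u + (c * θc) * (if u = 0 then 1 else Complex.sinh u / u) := by
  have hs := tel_summable (c * θc) w
  have hrows : HasSum (fun n : ℕ => ∑' j : ℕ, (w : ℂ) ^ n / (n.factorial : ℂ) *
        (((c * θc) ^ 2) ^ j / (j.factorial : ℂ)) * telPhi (c * θc) (n + j)) _ :=
    hs.hasSum.prod_fiberwise fun n => (hs.prod_factor n).hasSum
  have hd := (Finset.HasAntidiagonal.sigmaAntidiagonalEquivProd (A := ℕ)).hasSum_iff.2 hs.hasSum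
  have hd2 := hd.sigma fun k => hasSum_fintype _
  have hd3 := tel_diag (c * θc) w u (by rw [hu]; ring)
  have hE : ∑' p : ℕ × ℕ, (w : ℂ) ^ p.1 / (p.1.factorial : ℂ) *
        (((c * θc) ^ 2) ^ p.2 / (p.2.factorial : ℂ)) * telPhi (c * θc) (p.1 + p.2) =
      Complex.cosh u + (c * θc) * (if u = 0 then 1 else Complex.sinh u / u) := by
    refine hd2.unique ?_
    convert hd3 using 1
    ext k
    rw [← tel_antidiag]
    exact Finset.sum_coe_sort (Finset.HasAntidiagonal.antidiagonal k) (fun p : ℕ × ℕ =>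
      (w : ℂ) ^ p.1 / (p.1.factorial : ℂ) *
        (((c * θc) ^ 2) ^ p.2 / (p.2.factorial : ℂ)) * telPhi (c * θc) (p.1 + p.2))
  rw [← hE, ← hrows.tsum_eq, hrows.summable.tsum_eq_zero_add]
  congr 1
  · exact (tel_row_zero (c * θc) w).tsum_eq.symm
  · refine tsum_congr fun n => ?_
    exact (tel_row θc hθc c w n).tsum_eq.symm
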